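/- Let 𝒳 ⊆ ℝ^n be nonempty closed convex. Suppose each preference map Pᵢ : X → subsets of Xᵢ is lower semicontinuous with open upper sections and satisfies xᵢ ∉ conv(Pᵢ(x)) for all x; suppose there exists ρ > 0 such that for each x ∈ 𝒳 with ‖x‖ > ρ there is z ∈ 𝒳 with ‖z‖ < ‖x‖ and zᵢ ∈ Pᵢ(x) for all i; and suppose there is ρ' > ρ with 𝒳 ∩ B̄(0,ρ') nonempty. Then the jointly convex GNEP Γ' = (𝒳, Kᵢ, Pᵢ), with Kᵢ(x) = {zᵢ ∈ Xᵢ : (x₋ᵢ, zᵢ) ∈ 𝒳}, admits an equilibrium. -/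

import Mathlib

/-- Scarf dominance of a finite set with respect to a family of rankings. -/
def ScarfDom {I α : Type*} (r : I → α → ℕ) (S : Finset α) : Prop :=
  ∀ y, ∃ i, ∀ s ∈ S, r i y ≤ r i s

theorem scarf_even_doors {I α : Type*} [Fintype I] [DecidableEq I] [DecidableEq α]
    (c : α → I) (i0 : I) (S : Finset α) (hS : S.card = Fintype.card I)
    (hc : S.image c ≠ Finset.univ) :
    Even (S.filter (fun x => (S.erase x).image c = Finset.univ.erase i0)).card := by
  classical
  by_cases he : S.filter (fun x => (S.erase x).image c = Finset.univ.erase i0) = ∅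
  · rw [he]; simp
  obtain ⟨x0, hx0⟩ := Finset.nonempty_iff_ne_empty.2 he
  rw [Finset.mem_filter] at hx0
  obtain ⟨hx0S, hx0⟩ := hx0
  have hinj : Set.InjOn c (S.erase x0) := by
    rw [← Finset.card_image_iff, hx0, Finset.card_erase_of_mem (Finset.mem_univ _),
      Finset.card_erase_of_mem hx0S, hS, Finset.card_univ]
  have himS : S.image c = insert (c x0) (Finset.univ.erase i0) := by
    rw [← hx0, ← Finset.image_insert, Finset.insert_erase hx0S]
  have hcx0 : c x0 ≠ i0 := by
    intro h
    apply hc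
    rw [himS, h, Finset.insert_erase (Finset.mem_univ _)]
  have : c x0 ∈ (S.erase x0).image c := by rw [hx0]; simp [hcx0]
  obtain ⟨x1, hx1, hx1c⟩ := Finset.mem_image.1 this
  have hx1' := Finset.mem_erase.1 hx1
  have hset : S.filter (fun x => (S.erase x).image c = Finset.univ.erase i0) = {x0, x1} := by
    ext x
    rw [Finset.mem_filter, Finset.mem_insert, Finset.mem_singleton]
    constructor
    · rintro ⟨hxS, hx⟩
      by_contra hne
      push Not at hne
      have hxe : x ∈ S.erase x0 := Finset.mem_erase.2 ⟨hne.1, hxS⟩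
      have h1 : c x ∈ (S.erase x).image c := by
        rw [hx, ← hx0]; exact Finset.mem_image_of_mem _ hxe
      obtain ⟨w, hw, hwc⟩ := Finset.mem_image.1 h1
      have hw' := Finset.mem_erase.1 hw
      by_cases hwx : w = x0
      · subst hwx
        exact hne.2 (hinj hxe hx1 (by rw [← hwc, hx1c]))
      · exact hw'.1 (hinj (Finset.mem_erase.2 ⟨hwx, hw'.2⟩) hxe hwc)
    · rintro (rfl | rfl)
      · exact ⟨hx0S, hx0⟩
      · refine ⟨hx1'.2, ?_⟩
        rw [← hx0]
        ext k
        simp only [Finset.mem_image, Finset.mem_erase]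
        constructor
        · rintro ⟨a, ⟨ha1, ha2⟩, rfl⟩
          by_cases hax : a = x0
          · subst hax; exact ⟨x, hx1', hx1c⟩
          · exact ⟨a, ⟨hax, ha2⟩, rfl⟩
        · rintro ⟨a, ⟨ha1, ha2⟩, rfl⟩
          by_cases hax : a = x
          · subst hax; exact ⟨x0, ⟨fun h => ha1 h.symm, hx0S⟩, hx1c.symm⟩
          · exact ⟨a, ⟨hax, ha2⟩, rfl⟩
  rw [hset, Finset.card_pair (fun h => hx1'.1 h.symm)]
  exact even_two

theorem scarf_two_rooms {I α : Type*} [Fintype I] [DecidableEq I] [Fintype α] [DecidableEq α]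
    (r : I → α → ℕ) (hr : ∀ i, Function.Injective (r i)) (τ : Finset α)
    (hne : τ.Nonempty) (hcard : τ.card + 1 = Fintype.card I) (hdom : ScarfDom r τ)
    (hY : ∀ k, ∃ y, ∀ l, l ≠ k → ∃ s ∈ τ, r l s < r l y)
    (p : α → Prop) [DecidablePred p] (hp : ∀ z, p z ↔ z ∉ τ ∧ ScarfDom r (insert z τ)) :
    Even (Finset.univ.filter p).card := by
  classical
  have hm : ∀ l, ∃ x ∈ τ, ∀ s ∈ τ, r l x ≤ r l s := fun l => τ.exists_min_image (r l) hne
  choose m hmτ hmin using hm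
  have hsurj : ∀ x ∈ τ, ∃ l, m l = x := by
    intro x hx
    obtain ⟨l, hl⟩ := hdom x
    exact ⟨l, hr l (le_antisymm (hmin l x hx) (hl _ (hmτ l)))⟩
  obtain ⟨i, -, j, -, hij, hmij⟩ : ∃ i ∈ (Finset.univ : Finset I), ∃ j ∈ (Finset.univ : Finset I),
      i ≠ j ∧ m i = m j :=
    Finset.exists_ne_map_eq_of_card_lt_of_maps_to (t := τ)
      (by rw [Finset.card_univ]; omega) (fun l _ => hmτ l)
  have hk : ∀ k, (∀ x ∈ τ, ∃ l, l ≠ k ∧ m l = x) →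
      Set.InjOn m ((Finset.univ.erase k : Finset I) : Set I) := by
    intro k h
    rw [← Finset.card_image_iff]
    have : (Finset.univ.erase k).image m = τ := by
      ext x
      simp only [Finset.mem_image, Finset.mem_erase, Finset.mem_univ, and_true]
      constructor
      · rintro ⟨l, -, rfl⟩; exact hmτ l
      · exact h x
    rw [this, Finset.card_erase_of_mem (Finset.mem_univ _), Finset.card_univ]; omega
  let Y : I → α → Prop := fun k y => ∀ l, l ≠ k → r l (m l) < r l y
  let A : I → α → Prop := fun k z => Y k z ∧ ∀ y, Y k y → r k y ≤ r k z
  have key : ∀ z, p z ↔ A i z ∨ A j z := by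
    intro z
    rw [hp]
    constructor
    · rintro ⟨hz, hd⟩
      obtain ⟨k, hkz⟩ := hd z
      have h1 : ∀ x ∈ τ, ∃ l, l ≠ k ∧ m l = x ∧ r l x < r l z := by
        intro x hx
        obtain ⟨l, hl⟩ := hd x
        have h2 : m l = x := hr l (le_antisymm (hmin l x hx)
          (hl _ (Finset.mem_insert_of_mem (hmτ l))))
        have h3 : r l x < r l z := lt_of_le_of_ne (hl _ (Finset.mem_insert_self _ _))
          (fun h => hz (hr l h ▸ hx))
        refine ⟨l, ?_, h2, h3⟩
        rintro rfl
        exact absurd (hkz x (Finset.mem_insert_of_mem hx)) (not_le.2 h3)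
      have hinj := hk k (fun x hx => let ⟨l, a, b, _⟩ := h1 x hx; ⟨l, a, b⟩)
      have hAk : A k z := by
        have hYk : Y k z := by
          intro l hl
          obtain ⟨l', h2, h3, h4⟩ := h1 (m l) (hmτ l)
          have : l' = l := hinj (by simp [h2]) (by simp [hl]) h3
          subst this; exact h4
        refine ⟨hYk, ?_⟩
        intro y hy
        obtain ⟨l, hl⟩ := hd y
        by_cases hlk : l = k
        · subst hlk; exact hl _ (Finset.mem_insert_self _ _)
        · exact absurd (hl _ (Finset.mem_insert_of_mem (hmτ l))) (not_le.2 (hy l hlk))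
      by_cases hik : i = k
      · left; rw [hik]; exact hAk
      by_cases hjk : j = k
      · right; rw [hjk]; exact hAk
      exact absurd (hinj (by simp [hik]) (by simp [hjk]) hmij) hij
    · have main : ∀ k k', k ≠ k' → m k = m k' → A k z → z ∉ τ ∧ ScarfDom r (insert z τ) := by
        rintro k k' hkk hmk ⟨hYz, hmax⟩
        refine ⟨?_, ?_⟩
        · intro hz
          obtain ⟨l, rfl⟩ := hsurj z hz
          by_cases hl : l = k
          · subst hl
            have := hYz k' (Ne.symm hkk)
            rw [hmk] at this
            exact lt_irrefl _ this
          · exact lt_irrefl _ (hYz l hl)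
        · intro y
          by_cases hy : Y k y
          · refine ⟨k, ?_⟩
            intro s hs
            rcases Finset.mem_insert.1 hs with rfl | hs
            · exact hmax y hy
            · obtain ⟨l, hl⟩ := hdom z
              have : l = k := by
                by_contra h
                exact absurd (hl _ (hmτ l)) (not_le.2 (hYz l h))
              subst this
              exact (hmax y hy).trans (hl s hs)
          · simp only [Y] at hy
            push Not at hy
            obtain ⟨l, hlk, hl⟩ := hy
            refine ⟨l, ?_⟩
            intro s hs
            rcases Finset.mem_insert.1 hs with rfl | hs
            · exact hl.trans (hYz l hlk).le
            · exact hl.trans (hmin l s hs)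
      rintro (h | h)
      · exact main i j hij hmij h
      · exact main j i hij.symm hmij.symm h
  have hA : ∀ k, ∃ z, A k z := by
    intro k
    obtain ⟨y, hy⟩ := hY k
    have hy' : Y k y := by
      intro l hl
      obtain ⟨s, hs, h⟩ := hy l hl
      exact (hmin l s hs).trans_lt h
    obtain ⟨z, hz, hzm⟩ := (Finset.univ.filter (Y k)).exists_max_image (r k) ⟨y, by simp [hy']⟩
    refine ⟨z, (Finset.mem_filter.1 hz).2, fun w hw => hzm w (by simp [hw])⟩
  have hAu : ∀ k z w, A k z → A k w → z = w := fun k z w hz hw =>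
    hr k (le_antisymm (hw.2 z hz.1) (hz.2 w hw.1))
  obtain ⟨zi, hzi⟩ := hA i
  obtain ⟨zj, hzj⟩ := hA j
  have hneq : zi ≠ zj := by
    rintro rfl
    obtain ⟨l, hl⟩ := hdom zi
    by_cases h : l = i
    · exact absurd (hl _ (hmτ l)) (not_le.2 (hzj.1 l (h ▸ hij)))
    · exact absurd (hl _ (hmτ l)) (not_le.2 (hzi.1 l h))
  have : Finset.univ.filter p = {zi, zj} := by
    ext z
    simp only [Finset.mem_filter, Finset.mem_univ, true_and, Finset.mem_insert,
      Finset.mem_singleton, key]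
    constructor
    · rintro (h | h)
      · left; exact hAu i _ _ h hzi
      · right; exact hAu j _ _ h hzj
    · rintro (rfl | rfl)
      · exact Or.inl hzi
      · exact Or.inr hzj
  rw [this, Finset.card_pair hneq]
  exact even_two

theorem scarf_lemma {I T : Type*} [Fintype I] [DecidableEq I] [Nonempty I] [Fintype T]
    [DecidableEq T] [Nonempty T] (r : I → T → ℕ) (hr : ∀ i, Function.Injective (r i))
    (c : T → I) :
    ∃ (σ : Finset T) (C : Finset I), (∀ i ∈ C, ∃ x ∈ σ, c x = i) ∧
      ∀ y, ∃ i ∈ C, ∀ x ∈ σ, r i y ≤ r i x := by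
  classical
  obtain ⟨i0⟩ := ‹Nonempty I›
  obtain ⟨tm, -, htm⟩ := (Finset.univ : Finset T).exists_max_image (r i0) Finset.univ_nonempty
  by_cases hn : Fintype.card I ≤ 1
  · have hsub : Subsingleton I := Fintype.card_le_one_iff_subsingleton.1 hn
    refine ⟨{tm}, {i0}, ?_, ?_⟩
    · intro i _
      exact ⟨tm, by simp, Subsingleton.elim _ _⟩
    · intro y
      refine ⟨i0, by simp, ?_⟩
      intro x hx
      rw [Finset.mem_singleton.1 hx]
      exact htm y (Finset.mem_univ _)
  push Not at hn
  obtain ⟨M, hM⟩ : ∃ M : ℕ, ∀ i t, r i t < M := by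
    refine ⟨∑ i, ∑ t, r i t + 1, fun i t => Nat.lt_succ_of_le ?_⟩
    exact (Finset.single_le_sum (f := fun t => r i t) (fun _ _ => Nat.zero_le _)
      (Finset.mem_univ t)).trans
      (Finset.single_le_sum (f := fun i => ∑ t, r i t) (fun _ _ => Nat.zero_le _)
      (Finset.mem_univ i))
  let e := Fintype.equivFin I
  let R : I → T ⊕ I → ℕ := fun l => Sum.elim (fun t => r l t + 1)
    (fun k => if k = l then 0 else M + 1 + (e k : ℕ))
  have R1 : ∀ l t, R l (Sum.inl t) = r l t + 1 := fun l t => rfl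
  have R0 : ∀ l, R l (Sum.inr l) = 0 := fun l => by simp [R]
  have R2 : ∀ l k, k ≠ l → R l (Sum.inr k) = M + 1 + (e k : ℕ) := fun l k h => by simp [R, h]
  have hR : ∀ l, Function.Injective (R l) := by
    intro l a b hab
    rcases a with t | k <;> rcases b with t' | k'
    · rw [R1, R1] at hab
      rw [hr l (Nat.succ_injective hab)]
    · rw [R1] at hab
      by_cases h : k' = l
      · subst h; rw [R0] at hab; omega
      · rw [R2 _ _ h] at hab; have := hM l t; omega
    · rw [R1] at hab
      by_cases h : k = l
      · subst h; rw [R0] at hab; omega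
      · rw [R2 _ _ h] at hab; have := hM l t'; omega
    · by_cases h : k = l <;> by_cases h' : k' = l
      · rw [h, h']
      · subst h; rw [R0, R2 _ _ h'] at hab; omega
      · subst h'; rw [R0, R2 _ _ h] at hab; omega
      · rw [R2 _ _ h, R2 _ _ h'] at hab
        have : e k = e k' := Fin.ext (by omega)
        rw [e.injective this]
  let cc : T ⊕ I → I := Sum.elim c id
  suffices h : ∃ S : Finset (T ⊕ I), ScarfDom R S ∧ S.image cc = Finset.univ by
    obtain ⟨S, hd, hS⟩ := h
    refine ⟨Finset.univ.filter (fun t => Sum.inl t ∈ S),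
      Finset.univ.filter (fun i => Sum.inr i ∉ S), ?_, ?_⟩
    · intro i hi
      have hi' := (Finset.mem_filter.1 hi).2
      have : i ∈ S.image cc := by rw [hS]; simp
      obtain ⟨a, ha, hai⟩ := Finset.mem_image.1 this
      rcases a with t | k
      · exact ⟨t, by simp [ha], hai⟩
      · exact absurd (show Sum.inr i ∈ S by rw [← hai]; exact ha) hi'
    · intro y
      obtain ⟨l, hl⟩ := hd (Sum.inl y)
      refine ⟨l, ?_, ?_⟩
      · rw [Finset.mem_filter]
        refine ⟨Finset.mem_univ _, fun h => ?_⟩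
        have := hl _ h
        rw [R1, R0] at this
        omega
      · intro x hx
        have := hl _ (Finset.mem_filter.1 hx).2
        rw [R1, R1] at this
        omega
  by_contra hcon
  push Not at hcon
  let Rooms : Finset (Finset (T ⊕ I)) := Finset.univ.filter
    (fun S => S.card = Fintype.card I ∧ ScarfDom R S)
  let Doors : Finset (Finset (T ⊕ I)) := Finset.univ.filter
    (fun τ => τ.card + 1 = Fintype.card I ∧ ScarfDom R τ ∧ τ.image cc = Finset.univ.erase i0)
  have hmono : ∀ {S τ : Finset (T ⊕ I)}, τ ⊆ S → ScarfDom R S → ScarfDom R τ := by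
    intro S τ h hd y
    obtain ⟨i, hi⟩ := hd y
    exact ⟨i, fun s hs => hi s (h hs)⟩
  have hdc := Finset.sum_card_bipartiteAbove_eq_sum_card_bipartiteBelow
    (s := Doors) (t := Rooms) (fun τ S => τ ⊆ S)
  have hbelow : ∀ S ∈ Rooms, Even (Doors.bipartiteBelow (fun τ S => τ ⊆ S) S).card := by
    intro S hS
    obtain ⟨hSc, hSd⟩ := (Finset.mem_filter.1 hS).2
    have h1 := scarf_even_doors cc i0 S hSc (hcon S hSd)
    convert h1 using 1
    symm
    refine Finset.card_bij (fun x _ => S.erase x) ?_ ?_ ?_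
    · intro x hx
      obtain ⟨hxS, hx⟩ := Finset.mem_filter.1 hx
      rw [Finset.mem_bipartiteBelow]
      refine ⟨Finset.mem_filter.2 ⟨Finset.mem_univ _, ?_, hmono (Finset.erase_subset _ _) hSd, hx⟩,
        Finset.erase_subset _ _⟩
      rw [Finset.card_erase_add_one hxS, hSc]
    · intro x hx y hy hxy
      have hxS := (Finset.mem_filter.1 hx).1
      by_contra hne
      have : x ∈ S.erase y := Finset.mem_erase.2 ⟨hne, hxS⟩
      rw [← hxy] at this
      exact (Finset.mem_erase.1 this).1 rfl
    · intro τ hτ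
      rw [Finset.mem_bipartiteBelow] at hτ
      obtain ⟨hτ, hsub⟩ := hτ
      obtain ⟨h2, h3, h4⟩ := (Finset.mem_filter.1 hτ).2
      obtain ⟨x, hx, hins⟩ := Finset.exists_eq_insert_iff.2 ⟨hsub, by omega⟩
      refine ⟨x, Finset.mem_filter.2 ⟨?_, ?_⟩, ?_⟩
      · rw [← hins]; exact Finset.mem_insert_self _ _
      · rw [← hins, Finset.erase_insert hx]; exact h4
      · rw [← hins, Finset.erase_insert hx]
  have habove : ∀ τ ∈ Doors, (Rooms.bipartiteAbove (fun τ S => τ ⊆ S) τ).card =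
      (Finset.univ.filter (fun z => z ∉ τ ∧ ScarfDom R (insert z τ))).card := by
    intro τ hτ
    obtain ⟨h2, h3, h4⟩ := (Finset.mem_filter.1 hτ).2
    symm
    refine Finset.card_bij (fun z _ => insert z τ) ?_ ?_ ?_
    · intro z hz
      obtain ⟨hz, hzd⟩ := (Finset.mem_filter.1 hz).2
      rw [Finset.mem_bipartiteAbove]
      refine ⟨Finset.mem_filter.2 ⟨Finset.mem_univ _, ?_, hzd⟩, Finset.subset_insert _ _⟩
      rw [Finset.card_insert_of_notMem hz, h2]
    · intro z hz w hw hzw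
      obtain ⟨hz, hzd⟩ := (Finset.mem_filter.1 hz).2
      have : z ∈ insert w τ := by rw [← hzw]; exact Finset.mem_insert_self _ _
      rcases Finset.mem_insert.1 this with h | h
      · exact h
      · exact absurd h hz
    · intro S hS
      rw [Finset.mem_bipartiteAbove] at hS
      obtain ⟨hS, hsub⟩ := hS
      obtain ⟨hSc, hSd⟩ := (Finset.mem_filter.1 hS).2
      obtain ⟨x, hx, hins⟩ := Finset.exists_eq_insert_iff.2 ⟨hsub, by omega⟩
      exact ⟨x, Finset.mem_filter.2 ⟨Finset.mem_univ _, hx, by rw [hins]; exact hSd⟩, hins⟩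
  let τ0 : Finset (T ⊕ I) := (Finset.univ.erase i0).image Sum.inr
  have hmem0 : ∀ l, Sum.inr l ∈ τ0 ↔ l ≠ i0 := by intro l; simp [τ0]
  have hmem0' : ∀ t, Sum.inl t ∉ τ0 := by intro t; simp [τ0]
  have hτ0 : τ0 ∈ Doors := by
    refine Finset.mem_filter.2 ⟨Finset.mem_univ _, ?_, ?_, ?_⟩
    · rw [Finset.card_image_of_injective _ Sum.inr_injective,
        Finset.card_erase_add_one (Finset.mem_univ _), Finset.card_univ]
    · rintro (t | l)
      · refine ⟨i0, ?_⟩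
        rintro (t' | k) hk
        · exact absurd hk (hmem0' _)
        · rw [R1, R2 _ _ ((hmem0 k).1 hk)]
          have := hM i0 t; omega
      · exact ⟨l, fun s _ => by rw [R0]; exact Nat.zero_le _⟩
    · rw [Finset.image_image]
      exact Finset.image_id
  have hodd0 : (Finset.univ.filter (fun z => z ∉ τ0 ∧ ScarfDom R (insert z τ0))).card = 1 := by
    rw [Finset.card_eq_one]
    refine ⟨Sum.inl tm, ?_⟩
    ext z
    simp only [Finset.mem_filter, Finset.mem_univ, true_and, Finset.mem_singleton]
    constructor
    · rintro ⟨hz, hd⟩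
      obtain ⟨l, hl⟩ := hd (Sum.inl tm)
      rcases z with t | k
      · have hl0 : l = i0 := by
          by_contra h
          have := hl (Sum.inr l) (Finset.mem_insert_of_mem ((hmem0 l).2 h))
          rw [R1, R0] at this; omega
        subst hl0
        have := hl _ (Finset.mem_insert_self _ _)
        rw [R1, R1] at this
        rw [hr l (le_antisymm (htm t (Finset.mem_univ _)) (by omega))]
      · exfalso
        have hk : k = i0 := by by_contra h; exact hz ((hmem0 k).2 h)
        have : Sum.inr l ∈ insert (Sum.inr k) τ0 := by
          by_cases h : l = i0
          · rw [h, hk]; exact Finset.mem_insert_self _ _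
          · exact Finset.mem_insert_of_mem ((hmem0 l).2 h)
        have := hl _ this
        rw [R1, R0] at this; omega
    · rintro rfl
      refine ⟨hmem0' _, ?_⟩
      rintro (t | l)
      · refine ⟨i0, ?_⟩
        intro s hs
        rcases Finset.mem_insert.1 hs with rfl | hs
        · rw [R1, R1]; have := htm t (Finset.mem_univ _); omega
        · rcases s with t' | k
          · exact absurd hs (hmem0' _)
          · rw [R1, R2 _ _ ((hmem0 k).1 hs)]
            have := hM i0 t; omega
      · exact ⟨l, fun s _ => by rw [R0]; exact Nat.zero_le _⟩
  have hevent : ∀ τ ∈ Doors.erase τ0,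
      Even (Rooms.bipartiteAbove (fun τ S => τ ⊆ S) τ).card := by
    intro τ hτ
    obtain ⟨hne, hτ⟩ := Finset.mem_erase.1 hτ
    rw [habove τ hτ]
    obtain ⟨h2, h3, h4⟩ := (Finset.mem_filter.1 hτ).2
    have hex : ∃ t, Sum.inl t ∈ τ := by
      by_contra hno
      push Not at hno
      apply hne
      ext a
      rcases a with t | k
      · simp [hno t, hmem0' t]
      · rw [hmem0]
        constructor
        · intro hk
          have : cc (Sum.inr k) ∈ τ.image cc := Finset.mem_image_of_mem _ hk
          rw [h4] at this
          exact (Finset.mem_erase.1 this).1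
        · intro hk
          have : k ∈ τ.image cc := by rw [h4]; simp [hk]
          obtain ⟨a, ha, hak⟩ := Finset.mem_image.1 this
          rcases a with t | k'
          · exact absurd ha (hno t)
          · rw [← hak]; exact ha
    obtain ⟨t, ht⟩ := hex
    refine scarf_two_rooms R hR τ ⟨_, ht⟩ h2 h3 ?_ _ (fun z => Iff.rfl)
    intro k
    refine ⟨Sum.inr k, fun l hl => ⟨_, ht, ?_⟩⟩
    rw [R1, R2 _ _ (Ne.symm hl)]
    have := hM l t; omega
  have hE : Even (∑ τ ∈ Doors, (Rooms.bipartiteAbove (fun τ S => τ ⊆ S) τ).card) := by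
    rw [hdc]
    exact Finset.even_sum _ hbelow
  rw [← Finset.add_sum_erase _ _ hτ0, habove τ0 hτ0, hodd0] at hE
  have hE2 := Finset.even_sum _ hevent
  rw [Nat.even_add] at hE
  exact absurd (hE.2 hE2) (by decide)

theorem scarf_grid {I : Type*} [Fintype I] [DecidableEq I] [Nonempty I] (N : ℕ)
    (c : (I → ℕ) → I) :
    ∃ (σ : Finset (I → ℕ)) (C : Finset I), σ.Nonempty ∧ (∀ x ∈ σ, ∑ i, x i = N) ∧
      (∀ i ∈ C, ∃ x ∈ σ, c x = i) ∧
      (∀ x ∈ σ, ∀ x' ∈ σ, ∀ i, x i ≤ x' i + Fintype.card I) ∧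
      (∀ x ∈ σ, ∀ i, i ∉ C → x i ≤ Fintype.card I) := by
  classical
  let G : Finset (I → ℕ) := Finset.piAntidiag Finset.univ N
  have hG : ∀ a, a ∈ G ↔ ∑ i, a i = N := by
    intro a; simp [G, Finset.mem_piAntidiag]
  obtain ⟨i0⟩ := ‹Nonempty I›
  have hne : Nonempty G := ⟨⟨Pi.single i0 N, (hG _).2 (by simp)⟩⟩
  let M := Fintype.card G
  let e := Fintype.equivFin G
  let r : I → G → ℕ := fun i a => a.1 i * M + (e a : ℕ)
  have hle : ∀ i a b, r i a ≤ r i b → a.1 i ≤ b.1 i := by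
    intro i a b h
    by_contra hlt
    push Not at hlt
    have h1 : (b.1 i + 1) * M ≤ a.1 i * M := Nat.mul_le_mul_right _ hlt
    have h2 : (e b : ℕ) < M := (e b).2
    simp only [r] at h
    rw [add_mul] at h1
    omega
  have hr : ∀ i, Function.Injective (r i) := by
    intro i a b h
    have h1 := le_antisymm (hle i a b h.le) (hle i b a h.ge)
    simp only [r, h1] at h
    exact e.injective (Fin.ext (by omega))
  obtain ⟨σ, C, hC, hdom⟩ := scarf_lemma r hr (fun a => c a.1)
  obtain ⟨g0⟩ := hne
  obtain ⟨i1, hi1, -⟩ := hdom g0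
  obtain ⟨x1, hx1, -⟩ := hC i1 hi1
  have hmin : ∀ i, ∃ w ∈ σ, ∀ x ∈ σ, w.1 i ≤ x.1 i := fun i =>
    σ.exists_min_image (fun w => w.1 i) ⟨x1, hx1⟩
  choose w hw hwm using hmin
  let μ : I → ℕ := fun i => if i ∈ C then (w i).1 i else 0
  have hμx : ∀ x ∈ σ, ∀ i, μ i ≤ x.1 i := by
    intro x hx i
    simp only [μ]
    split_ifs
    · exact hwm i x hx
    · exact Nat.zero_le _
  have hsum : N < ∑ i, (μ i + 1) := by
    by_contra hcon
    push Not at hcon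
    let y : I → ℕ := fun i => (μ i + 1) + (if i = i1 then N - ∑ i, (μ i + 1) else 0)
    have hy : y ∈ G := by
      rw [hG]
      simp only [y]
      rw [Finset.sum_add_distrib (f := fun i => μ i + 1)]
      simp only [Finset.sum_ite_eq', Finset.mem_univ, if_true]
      omega
    obtain ⟨i, hi, h⟩ := hdom ⟨y, hy⟩
    have h1 := hle _ _ _ (h (w i) (hw i))
    simp only [y, μ, hi, if_true] at h1
    omega
  have hsum' : N ≤ ∑ i, μ i + Fintype.card I := by
    rw [Finset.sum_add_distrib] at hsum
    simp at hsum
    omega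
  have hup : ∀ x ∈ σ, ∀ i, x.1 i ≤ μ i + Fintype.card I := by
    intro x hx i
    have h1 : ∑ i, x.1 i = N := (hG _).1 x.2
    rw [← Finset.add_sum_erase _ _ (Finset.mem_univ i)] at h1 hsum'
    have h2 : ∑ j ∈ Finset.univ.erase i, μ j ≤ ∑ j ∈ Finset.univ.erase i, x.1 j :=
      Finset.sum_le_sum (fun j _ => hμx x hx j)
    omega
  refine ⟨σ.image Subtype.val, C, ⟨x1.1, Finset.mem_image_of_mem _ hx1⟩, ?_, ?_, ?_, ?_⟩
  · intro x hx
    obtain ⟨a, ha, rfl⟩ := Finset.mem_image.1 hx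
    exact (hG _).1 a.2
  · intro i hi
    obtain ⟨x, hx, hxc⟩ := hC i hi
    exact ⟨x.1, Finset.mem_image_of_mem _ hx, hxc⟩
  · intro x hx x' hx' i
    obtain ⟨a, ha, rfl⟩ := Finset.mem_image.1 hx
    obtain ⟨b, hb, rfl⟩ := Finset.mem_image.1 hx'
    have := hup a ha i
    have := hμx b hb i
    omega
  · intro x hx i hi
    obtain ⟨a, ha, rfl⟩ := Finset.mem_image.1 hx
    have := hup a ha i
    simp only [μ, hi, if_false] at this
    omega

theorem brouwer_simplex {I : Type*} [Fintype I] [Nonempty I]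
    (f : (I → ℝ) → (I → ℝ)) (hf : ContinuousOn f (stdSimplex ℝ I))
    (hm : Set.MapsTo f (stdSimplex ℝ I) (stdSimplex ℝ I)) :
    ∃ x ∈ stdSimplex ℝ I, f x = x := by
  classical
  obtain ⟨i0⟩ := ‹Nonempty I›
  have hcpt : IsCompact (stdSimplex ℝ I) := isCompact_stdSimplex ℝ I
  have hfi : ∀ i, ContinuousOn (fun x => f x i) (stdSimplex ℝ I) := fun i =>
    (continuous_apply i).comp_continuousOn hf
  have hcont : ContinuousOn (fun x => ∑ i, max 0 (x i - f x i)) (stdSimplex ℝ I) := by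
    refine continuousOn_finsetSum _ (fun i _ => ?_)
    exact ContinuousOn.sup continuousOn_const ((continuous_apply i).continuousOn.sub (hfi i))
  obtain ⟨x, hx, hxmin⟩ := hcpt.exists_isMinOn ⟨_, single_mem_stdSimplex ℝ i0⟩ hcont
  refine ⟨x, hx, ?_⟩
  by_cases h0 : ∑ i, max 0 (x i - f x i) ≤ 0
  · have h1 : ∀ i, x i ≤ f x i := by
      intro i
      have h2 := (Finset.single_le_sum (f := fun i => max 0 (x i - f x i))
        (fun _ _ => le_max_left _ _) (Finset.mem_univ i)).trans h0
      have := (le_max_right _ _).trans h2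
      linarith
    have h3 := (Finset.sum_eq_sum_iff_of_le (s := Finset.univ) (fun i _ => h1 i)).1
      (by rw [hx.2, (hm hx).2])
    funext i
    exact (h3 i (Finset.mem_univ _)).symm
  exfalso
  push Not at h0
  set η := ∑ i, max 0 (x i - f x i) with hη
  have hcard : (0 : ℝ) < Fintype.card I := by
    exact_mod_cast Fintype.card_pos_iff.2 ⟨i0⟩
  obtain ⟨ε, hε, hεη⟩ : ∃ ε > 0, Fintype.card I * (2 * ε) < η := by
    refine ⟨η / (4 * Fintype.card I), by positivity, ?_⟩
    have : (Fintype.card I : ℝ) * (2 * (η / (4 * Fintype.card I))) = η / 2 := by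
      field_simp; norm_num
    rw [this]; linarith
  have huc := hcpt.uniformContinuousOn_of_continuous hf
  rw [Metric.uniformContinuousOn_iff] at huc
  obtain ⟨δ, hδ, huc⟩ := huc ε hε
  obtain ⟨N, hN⟩ := exists_nat_gt (Fintype.card I / min δ ε)
  have hmin : 0 < min δ ε := lt_min hδ hε
  have hNpos : (0 : ℝ) < N := lt_of_le_of_lt (by positivity) hN
  have hN' : Fintype.card I / (N : ℝ) < min δ ε := by
    rw [div_lt_iff₀ hmin] at hN
    rw [div_lt_iff₀ hNpos]; linarith
  let s : (I → ℕ) → (I → ℝ) := fun a i => a i / N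
  have hs : ∀ a : I → ℕ, ∑ i, a i = N → s a ∈ stdSimplex ℝ I := by
    intro a ha
    refine ⟨fun i => by simp only [s]; positivity, ?_⟩
    simp only [s]
    rw [← Finset.sum_div, ← Nat.cast_sum, ha, div_self hNpos.ne']
  have hcol : ∀ a : I → ℕ, ∃ i, ∑ i, a i = N → s a i ≤ f (s a) i := by
    intro a
    by_cases ha : ∑ i, a i = N
    · by_contra hcon
      push Not at hcon
      have h1 : ∑ i, f (s a) i < ∑ i, s a i :=
        Finset.sum_lt_sum_of_nonempty ⟨i0, Finset.mem_univ _⟩ (fun i _ => (hcon i).2)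
      rw [(hs a ha).2, (hm (hs a ha)).2] at h1
      exact lt_irrefl _ h1
    · exact ⟨i0, fun h => absurd h ha⟩
  choose c hc using hcol
  have : Nonempty I := ⟨i0⟩
  obtain ⟨σ, C, ⟨a, ha⟩, hσ, hC, hclose, hout⟩ := scarf_grid N c
  have hsc : ∀ a ∈ σ, ∀ b ∈ σ, ∀ i, s a i ≤ s b i + Fintype.card I / N := by
    intro a ha b hb i
    simp only [s]
    rw [← add_div]
    have := hclose a ha b hb i
    gcongr
    exact_mod_cast this
  have hbound : ∀ i, max 0 (s a i - f (s a) i) ≤ 2 * ε := by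
    intro i
    refine max_le (by positivity) ?_
    by_cases hi : i ∈ C
    · obtain ⟨b, hb, hbc⟩ := hC i hi
      have h1 := hc b (hσ b hb)
      rw [hbc] at h1
      have hd : dist (s a) (s b) < δ := by
        refine lt_of_le_of_lt ((dist_pi_le_iff (by positivity)).2 (fun j => ?_))
          (hN'.trans_le (min_le_left _ _))
        rw [Real.dist_eq, abs_le]
        have := hsc a ha b hb j
        have := hsc b hb a ha j
        constructor <;> linarith
      have h2 := huc _ (hs a (hσ a ha)) _ (hs b (hσ b hb)) hd
      have h3 := (dist_le_pi_dist _ _ i).trans_lt h2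
      rw [Real.dist_eq, abs_lt] at h3
      have h4 := hsc a ha b hb i
      have h5 := hN'.trans_le (min_le_right _ _)
      linarith [h3.1]
    · have h1 : s a i ≤ Fintype.card I / N := by
        simp only [s]
        have := hout a ha i hi
        gcongr
      have h5 := hN'.trans_le (min_le_right _ _)
      have h6 := (hm (hs a (hσ a ha))).1 i
      linarith
  have hfin : ∑ i, max 0 (s a i - f (s a) i) ≤ Fintype.card I * (2 * ε) := by
    have := Finset.sum_le_card_nsmul Finset.univ _ _ (fun i _ => hbound i)
    rw [Finset.card_univ, nsmul_eq_mul] at this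
    exact this
  have := hxmin (hs a (hσ a ha))
  simp only [Set.mem_ofPred_eq] at this
  linarith

theorem browder_selection {E : Type*} [NormedAddCommGroup E] [NormedSpace ℝ E] (C : Set E)
    (hC : IsCompact C) (hconv : Convex ℝ C) (hne : C.Nonempty) (F : E → Set E)
    (hF : ∀ x, Convex ℝ (F x))
    (hloc : ∀ x ∈ C, ∃ y ∈ C, ∀ᶠ x' in nhdsWithin x C, y ∈ F x') :
    ∃ x ∈ C, x ∈ F x := by
  classical
  have h1 : ∀ x : C, ∃ y ∈ C, ∃ ρ > 0, ∀ x' ∈ C, dist x' x < ρ → y ∈ F x' := by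
    intro x
    obtain ⟨y, hy, h⟩ := hloc x.1 x.2
    rw [Filter.Eventually, Metric.mem_nhdsWithin_iff] at h
    obtain ⟨ρ, hρ, h⟩ := h
    exact ⟨y, hy, ρ, hρ, fun x' hx' hd => h ⟨Metric.mem_ball.2 hd, hx'⟩⟩
  choose y hy ρ hρ h using h1
  obtain ⟨t, ht⟩ := hC.elim_finite_subcover (fun x : C => Metric.ball x.1 (ρ x))
    (fun _ => Metric.isOpen_ball)
    (fun x hx => Set.mem_iUnion.2 ⟨⟨x, hx⟩, Metric.mem_ball_self (hρ _)⟩)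
  have hcov : ∀ x ∈ C, ∃ k : t, dist x k.1.1 < ρ k.1 := by
    intro x hx
    obtain ⟨k, hk, hxk⟩ := Set.mem_iUnion₂.1 (ht hx)
    exact ⟨⟨k, hk⟩, hxk⟩
  have hI : Nonempty t := by
    obtain ⟨x, hx⟩ := hne
    obtain ⟨k, -⟩ := hcov x hx
    exact ⟨k⟩
  let g : t → E → ℝ := fun k x => max 0 (ρ k.1 - dist x k.1.1)
  have hg0 : ∀ k x, 0 ≤ g k x := fun k x => le_max_left _ _
  have hgc : ∀ k, Continuous (g k) := fun k => by
    simp only [g]; fun_prop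
  have hgs : ∀ x ∈ C, 0 < ∑ k, g k x := by
    intro x hx
    obtain ⟨k, hk⟩ := hcov x hx
    refine Finset.sum_pos' (fun k _ => hg0 k x) ⟨k, Finset.mem_univ _, ?_⟩
    exact lt_max_of_lt_right (by linarith)
  let b : (t → ℝ) → E := fun w => ∑ k, w k • y k.1
  have hbc : Continuous b := by simp only [b]; fun_prop
  have hbC : ∀ w ∈ stdSimplex ℝ t, b w ∈ C := fun w hw =>
    hconv.sum_mem (fun k _ => hw.1 k) hw.2 (fun k _ => hy k.1)
  obtain ⟨w, hw, hwf⟩ := brouwer_simplex (fun w k => g k (b w) / ∑ l, g l (b w))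
    (by
      refine continuousOn_pi.2 (fun k => ContinuousOn.div ?_ ?_ ?_)
      · exact ((hgc k).comp hbc).continuousOn
      · exact (continuous_finsetSum _ (fun l _ => (hgc l).comp hbc)).continuousOn
      · exact fun w hw => (hgs _ (hbC w hw)).ne')
    (by
      intro w hw
      refine ⟨fun k => div_nonneg (hg0 _ _) (hgs _ (hbC w hw)).le, ?_⟩
      rw [← Finset.sum_div, div_self (hgs _ (hbC w hw)).ne'])
  refine ⟨b w, hbC w hw, ?_⟩
  have hpos : ∀ k, w k ≠ 0 → y k.1 ∈ F (b w) := by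
    intro k hk
    apply h k.1 _ (hbC w hw)
    by_contra hcon
    apply hk
    rw [← hwf]
    have : g k (b w) = 0 := max_eq_left (by linarith)
    simp [this]
  have hsum : b w = ∑ k ∈ Finset.univ.filter (fun k => w k ≠ 0), w k • y k.1 := by
    simp only [b]
    rw [Finset.sum_filter_of_ne]
    intro k _ hk h0
    exact hk (by rw [h0, zero_smul])
  have hone : ∑ k ∈ Finset.univ.filter (fun k => w k ≠ 0), w k = 1 := by
    rw [Finset.sum_filter_ne_zero, hw.2]
  rw [hsum]
  rw [← hsum]
  have := (hF (b w)).sum_mem (t := Finset.univ.filter (fun k => w k ≠ 0)) (w := w)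
    (z := fun k => y k.1) (fun k _ => hw.1 k) hone
    (fun k hk => hpos k (Finset.mem_filter.1 hk).2)
  rwa [← hsum] at this

open scoped RealInnerProductSpace

theorem uniform_neg {V X : Type*} [NormedAddCommGroup V] [InnerProductSpace ℝ V]
    [FiniteDimensional ℝ V] (l : Filter X) (Q : X → Set V) (a : X → V) (Q0 : Set V)
    (hQ0 : IsOpen Q0) (z : V) (hz : z ∈ Q0)
    (hlsc : ∀ O : Set V, IsOpen O → (Q0 ∩ O).Nonempty → ∀ᶠ x in l, (Q x ∩ O).Nonempty) :
    ∃ ε > 0, ∀ᶠ x in l, ∀ v : V, ‖v‖ = 1 → (∀ w ∈ Q x, ⟪v, w - a x⟫ ≤ 0) →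
      ⟪v, z - a x⟫ ≤ -ε := by
  obtain ⟨δ, hδ, hball⟩ := Metric.isOpen_iff.1 hQ0 z hz
  obtain ⟨t, hts, htf, hcov⟩ := (isCompact_sphere (0 : V) 1).finite_cover_balls
    (e := 1 / 4) (by norm_num)
  refine ⟨δ / 4, by positivity, ?_⟩
  have h1 : ∀ᶠ x in l, ∀ u ∈ t, (Q x ∩ Metric.ball (z + (δ / 2) • u) (δ / 8)).Nonempty := by
    rw [htf.eventually_all]
    intro u hu
    refine hlsc _ Metric.isOpen_ball ⟨_, hball ?_, Metric.mem_ball_self (by positivity)⟩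
    have hu1 : ‖u‖ = 1 := by simpa using hts hu
    rw [Metric.mem_ball, dist_eq_norm, add_sub_cancel_left, norm_smul, hu1, mul_one,
      Real.norm_of_nonneg (by positivity)]
    linarith
  filter_upwards [h1] with x hx v hv hN
  obtain ⟨u, hu, hvu⟩ := Set.mem_iUnion₂.1 (hcov (show v ∈ Metric.sphere (0 : V) 1 by simpa using hv))
  obtain ⟨w, hwQ, hwb⟩ := hx u hu
  have h2 := hN w hwQ
  rw [Metric.mem_ball, dist_eq_norm] at hvu hwb
  have h3 : ⟪v, v - u⟫ ≤ 1 / 4 := by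
    have := real_inner_le_norm v (v - u)
    rw [hv] at this; linarith
  have h4 : ⟪v, u⟫ ≥ 3 / 4 := by
    rw [inner_sub_right, real_inner_self_eq_norm_sq, hv] at h3; linarith
  have h5 : ⟪v, (z + (δ / 2) • u) - w⟫ ≤ δ / 8 := by
    have := real_inner_le_norm v ((z + (δ / 2) • u) - w)
    rw [hv, norm_sub_rev] at this; linarith
  rw [inner_sub_right, inner_add_right, inner_smul_right] at h5
  rw [inner_sub_right] at h2 ⊢
  nlinarith

/-- Admissible normals. -/
def NormalSel {V : Type*} [NormedAddCommGroup V] [InnerProductSpace ℝ V] (Q : Set V) (a v : V) :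
    Prop :=
  ‖v‖ ≤ 1 ∧ (Q.Nonempty → ‖v‖ = 1 ∧ ∀ w ∈ Q, ⟪v, w - a⟫ ≤ 0)

theorem normalSel_exists {V : Type*} [NormedAddCommGroup V] [InnerProductSpace ℝ V]
    [FiniteDimensional ℝ V] (Q : Set V) (hQ : IsOpen Q) (a : V) (ha : a ∉ convexHull ℝ Q) :
    ∃ v, NormalSel Q a v := by
  by_cases hne : Q.Nonempty
  · obtain ⟨f, hf⟩ := geometric_hahn_banach_open_point (convex_convexHull ℝ Q) hQ.convexHull ha
    obtain ⟨q, hq⟩ := hne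
    let u := (InnerProductSpace.toDual ℝ V).symm f
    have hu : ∀ x, ⟪u, x⟫ = f x := fun x => by simp [u]
    have hu0 : u ≠ 0 := by
      intro h0
      have h1 := hf q (subset_convexHull ℝ Q hq)
      rw [← hu, ← hu, h0] at h1
      simp at h1
    have hn : ‖(‖u‖⁻¹) • u‖ = 1 := norm_smul_inv_norm (𝕜 := ℝ) hu0
    refine ⟨(‖u‖⁻¹) • u, hn.le, fun _ => ⟨hn, fun w hw => ?_⟩⟩
    rw [real_inner_smul_left, inner_sub_right, hu, hu]
    have := hf w (subset_convexHull ℝ Q hw)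
    exact mul_nonpos_of_nonneg_of_nonpos (by positivity) (by linarith)
  · exact ⟨0, by simp, fun h => absurd h hne⟩

/-- Existence of an equilibrium for the jointly convex GNEP `Γ' = (𝒳, Kᵢ, Pᵢ)` with
(possibly) unbounded joint constraint set, under a coercivity condition. -/
theorem jointly_convex_GNEP_exists (ι : Type*) [Fintype ι] [DecidableEq ι] [Nonempty ι]
    (n : ι → ℕ)
    (𝒳 : Set (∀ j, EuclideanSpace ℝ (Fin (n j))))
    (h𝒳ne : 𝒳.Nonempty) (h𝒳cl : IsClosed 𝒳) (h𝒳conv : Convex ℝ 𝒳)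
    (Xs : ∀ i, Set (EuclideanSpace ℝ (Fin (n i))))
    (hproj : ∀ i, Xs i = (fun x => x i) '' 𝒳)
    (P : ∀ i, (∀ j, EuclideanSpace ℝ (Fin (n j))) → Set (EuclideanSpace ℝ (Fin (n i))))
    (hPsub : ∀ i x, P i x ⊆ Xs i)
    -- (a) each `Pᵢ` is lower semicontinuous with open upper sections and `xᵢ ∉ conv(Pᵢ(x))`
    (hlsc : ∀ i, ∀ x ∈ Set.pi Set.univ Xs, ∀ V : Set (EuclideanSpace ℝ (Fin (n i))),
      IsOpen V → (P i x ∩ V).Nonempty →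
      ∃ U ∈ nhdsWithin x (Set.pi Set.univ Xs), ∀ x' ∈ U, (P i x' ∩ V).Nonempty)
    (hopen : ∀ i x, IsOpen (P i x))
    (hnotin : ∀ i x, x i ∉ convexHull ℝ (P i x))
    -- (b) coercivity
    (ρ : ℝ) (hρ : 0 < ρ)
    (hcoer : ∀ x ∈ 𝒳, ρ < ‖x‖ →
      ∃ z ∈ 𝒳, ‖z‖ < ‖x‖ ∧ ∀ i, z i ∈ P i x)
    -- (c) a larger truncation meeting `𝒳`
    (ρ' : ℝ) (hρ' : ρ < ρ')
    (hmeet : (𝒳 ∩ Metric.closedBall 0 ρ').Nonempty)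
    (K : ∀ i, (∀ j, EuclideanSpace ℝ (Fin (n j))) → Set (EuclideanSpace ℝ (Fin (n i))))
    (hK : ∀ i x, K i x = {z ∈ Xs i | Function.update x i z ∈ 𝒳}) :
    ∃ xt ∈ 𝒳, ∀ i, P i xt ∩ K i xt = ∅ := by
  classical
  have hCcpt : IsCompact (𝒳 ∩ Metric.closedBall 0 ρ') :=
    (isCompact_closedBall 0 ρ').inter_left h𝒳cl
  have hCconv : Convex ℝ (𝒳 ∩ Metric.closedBall 0 ρ') :=
    h𝒳conv.inter (convex_closedBall 0 ρ')
  have hXpi : 𝒳 ⊆ Set.pi Set.univ Xs := by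
    intro x hx i _
    rw [hproj]
    exact ⟨x, hx, rfl⟩
  by_contra hcon
  push Not at hcon
  let F : (∀ j, EuclideanSpace ℝ (Fin (n j))) → Set (∀ j, EuclideanSpace ℝ (Fin (n j))) :=
    fun x => {y | ∀ v : ∀ j, EuclideanSpace ℝ (Fin (n j)),
      (∀ i, NormalSel (P i x) (x i) (v i)) → ∑ i, ⟪v i, y i - x i⟫ < 0}
  have hlsc' : ∀ x ∈ 𝒳, ∀ i, ∀ O : Set (EuclideanSpace ℝ (Fin (n i))), IsOpen O →
      (P i x ∩ O).Nonempty →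
      ∀ᶠ x' in nhdsWithin x (𝒳 ∩ Metric.closedBall 0 ρ'), (P i x' ∩ O).Nonempty := by
    intro x hx i O hO hne
    obtain ⟨U, hU, h⟩ := hlsc i x (hXpi hx) O hO hne
    have hU' := nhdsWithin_mono x (Set.inter_subset_left.trans hXpi :
      𝒳 ∩ Metric.closedBall 0 ρ' ⊆ Set.pi Set.univ Xs) hU
    filter_upwards [hU'] with x' hx' using h x' hx'
  have hneg : ∀ x ∈ 𝒳, ∀ i, ∀ z ∈ P i x, ∃ ε > 0,
      ∀ᶠ x' in nhdsWithin x (𝒳 ∩ Metric.closedBall 0 ρ'), ∀ v,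
        NormalSel (P i x') (x' i) v → ⟪v, z - x' i⟫ ≤ -ε := by
    intro x hx i z hz
    obtain ⟨ε, hε, h⟩ := uniform_neg (nhdsWithin x (𝒳 ∩ Metric.closedBall 0 ρ'))
      (fun x' => P i x') (fun x' => x' i) (P i x) (hopen i x) z hz (hlsc' x hx i)
    refine ⟨ε, hε, ?_⟩
    filter_upwards [h, hlsc' x hx i Set.univ isOpen_univ ⟨z, hz, trivial⟩] with x' h1 h2 v hv
    obtain ⟨h3, h4⟩ := hv.2 (h2.mono Set.inter_subset_left)
    exact h1 v h3 h4
  have hcv : ∀ x, Convex ℝ (F x) := by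
    intro x y hy y' hy' a b ha hb hab v hv
    have h1 := hy v hv
    have h2 := hy' v hv
    have h3 : ∑ i, ⟪v i, (a • y + b • y') i - x i⟫ =
        a * ∑ i, ⟪v i, y i - x i⟫ + b * ∑ i, ⟪v i, y' i - x i⟫ := by
      rw [Finset.mul_sum, Finset.mul_sum, ← Finset.sum_add_distrib]
      refine Finset.sum_congr rfl (fun i _ => ?_)
      have : (a • y + b • y') i - x i = a • (y i - x i) + b • (y' i - x i) := by
        have hx : x i = (a + b) • x i := by rw [hab, one_smul]
        conv_lhs => rw [hx]
        simp only [Pi.add_apply, Pi.smul_apply]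
        module
      rw [this, inner_add_right, inner_smul_right, inner_smul_right]
    rw [h3]
    rcases ha.eq_or_lt with rfl | ha
    · have : b = 1 := by linarith
      subst this; linarith
    · nlinarith [mul_neg_of_pos_of_neg ha h1, mul_nonpos_of_nonneg_of_nonpos hb h2.le]
  have hloc : ∀ x ∈ 𝒳 ∩ Metric.closedBall 0 ρ', ∃ y ∈ 𝒳 ∩ Metric.closedBall 0 ρ',
      ∀ᶠ x' in nhdsWithin x (𝒳 ∩ Metric.closedBall 0 ρ'), y ∈ F x' := by
    rintro x ⟨hx, hxb⟩
    rw [mem_closedBall_zero_iff] at hxb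
    by_cases hxρ : ρ < ‖x‖
    · obtain ⟨z, hz, hzx, hzP⟩ := hcoer x hx hxρ
      refine ⟨z, ⟨hz, by rw [mem_closedBall_zero_iff]; linarith⟩, ?_⟩
      choose ε hε h using fun i => hneg x hx i (z i) (hzP i)
      filter_upwards [Filter.eventually_all.2 h] with x' hx' v hv
      refine Finset.sum_neg (fun i _ => ?_) Finset.univ_nonempty
      have := hx' i (v i) (hv i)
      have := hε i
      linarith
    · push Not at hxρ
      obtain ⟨i, z, hzP, hzK⟩ := hcon x hx
      rw [hK] at hzK
      obtain ⟨ε, hε, h⟩ := hneg x hx i z hzP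
      set q := Function.update x i z with hq
      have hq𝒳 : q ∈ 𝒳 := hzK.2
      obtain ⟨s, hs0, hs1, hsn⟩ : ∃ s : ℝ, 0 < s ∧ s ≤ 1 ∧ s * ‖q - x‖ ≤ ρ' - ρ := by
        refine ⟨min 1 ((ρ' - ρ) / (‖q - x‖ + 1)), ?_, min_le_left _ _, ?_⟩
        · have : 0 < ρ' - ρ := by linarith
          exact lt_min one_pos (by positivity)
        · have h1 : 0 < ρ' - ρ := by linarith
          calc _ ≤ (ρ' - ρ) / (‖q - x‖ + 1) * (‖q - x‖ + 1) :=
                mul_le_mul (min_le_right _ _) (by linarith) (norm_nonneg _) (by positivity)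
            _ = ρ' - ρ := by field_simp
      refine ⟨x + s • (q - x), ⟨h𝒳conv.add_smul_sub_mem hx hq𝒳 ⟨hs0.le, hs1⟩, ?_⟩, ?_⟩
      · rw [mem_closedBall_zero_iff]
        have h1 := norm_add_le x (s • (q - x))
        rw [norm_smul, Real.norm_of_nonneg hs0.le] at h1
        linarith
      have hcont : ∀ᶠ x' in nhdsWithin x (𝒳 ∩ Metric.closedBall 0 ρ'),
          ∑ l, ‖x l - x' l‖ + s * ‖x' i - x i‖ < s * ε := by
        apply Filter.Eventually.filter_mono nhdsWithin_le_nhds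
        have hc : Continuous (fun x' : ∀ j, EuclideanSpace ℝ (Fin (n j)) =>
            ∑ l, ‖x l - x' l‖ + s * ‖x' i - x i‖) := by fun_prop
        refine (hc.tendsto x).eventually_lt_const ?_
        simp
        positivity
      filter_upwards [h, hcont] with x' h1 h2 v hv
      have h3 : ∑ l, ⟪v l, (x + s • (q - x)) l - x' l⟫ =
          ∑ l, ⟪v l, x l - x' l⟫ + s * (⟪v i, z - x' i⟫ + ⟪v i, x' i - x i⟫) := by
        have h4 : ∀ l, ⟪v l, (x + s • (q - x)) l - x' l⟫ =
            ⟪v l, x l - x' l⟫ + s * ⟪v l, q l - x l⟫ := by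
          intro l
          rw [← real_inner_smul_right, ← inner_add_right]
          congr 1
          simp only [Pi.add_apply, Pi.smul_apply, Pi.sub_apply]
          abel
        rw [Finset.sum_congr rfl (fun l _ => h4 l), Finset.sum_add_distrib, ← Finset.mul_sum]
        congr 2
        rw [Finset.sum_eq_single i]
        · rw [← inner_add_right]
          congr 1
          simp [hq]
        · intro l _ hl
          simp [hq, Function.update_of_ne hl]
        · intro hi
          exact absurd (Finset.mem_univ _) hi
      rw [h3]
      have hle : ∀ l (w : EuclideanSpace ℝ (Fin (n l))), ⟪v l, w⟫ ≤ ‖w‖ := by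
        intro l w
        have h5 := real_inner_le_norm (v l) w
        have h6 := mul_le_mul_of_nonneg_right (hv l).1 (norm_nonneg w)
        linarith
      have h5 : ∑ l, ⟪v l, x l - x' l⟫ ≤ ∑ l, ‖x l - x' l‖ :=
        Finset.sum_le_sum (fun l _ => hle l _)
      have h6 := mul_le_mul_of_nonneg_left (h1 (v i) (hv i)) hs0.le
      have h7 := mul_le_mul_of_nonneg_left (hle i (x' i - x i)) hs0.le
      linarith
  obtain ⟨x, hxC, hxF⟩ := browder_selection _ hCcpt hCconv hmeet F hcv hloc
  have hv : ∀ i, ∃ v, NormalSel (P i x) (x i) v := fun i =>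
    normalSel_exists _ (hopen i x) _ (hnotin i x)
  choose v hv using hv
  have := hxF v hv
  simp at this
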